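/- The vanishing ideal in ℂ[u_{ij} : 1≤i<j≤5] of the set of points u ∈ ℂ¹⁰ for which the 2-vector σ_u = Σ_{i<j} u_{ij} e_i∧e_j ∈ Λ²ℂ⁵ is decomposable (σ_u = v∧w for some v,w ∈ ℂ⁵), i.e., of the affine cone over Gr(2,5) in Plücker coordinates, equals the ideal (P₁,…,P₅) generated by the five Pfaffian quadrics. -/

import Mathlib

noncomputable section

/-- The polynomial ring `ℂ[u_{ij} : 1 ≤ i < j ≤ 5]` in ten variables. -/
abbrev PR : Type := MvPolynomial {p : Fin 5 × Fin 5 // p.1 < p.2} ℂ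

/-- The full skew-symmetric matrix of variables: `U i j = u_{ij}` for `i < j`,
`U j i = −u_{ij}`, `U i i = 0`. -/
def U (i j : Fin 5) : PR :=
  if h : i < j then MvPolynomial.X ⟨(i, j), h⟩
  else if h : j < i then -MvPolynomial.X ⟨(j, i), h⟩
  else 0

/-- The Pfaffian `P_k = u_{i₁i₂}u_{i₃i₄} − u_{i₁i₃}u_{i₂i₄} + u_{i₁i₄}u_{i₂i₃}` of the 4×4
skew-symmetric submatrix obtained by deleting the `k`-th row and column, where
`{i₁<i₂<i₃<i₄} = {1,…,5}∖{k}` (enumerated by `Fin.succAbove k`). -/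
def Pf (k : Fin 5) : PR :=
  U (k.succAbove 0) (k.succAbove 1) * U (k.succAbove 2) (k.succAbove 3) -
    U (k.succAbove 0) (k.succAbove 2) * U (k.succAbove 1) (k.succAbove 3) +
    U (k.succAbove 0) (k.succAbove 3) * U (k.succAbove 1) (k.succAbove 2)


/-- The exterior algebra `Λ(ℂ⁵)`. -/
abbrev E5 : Type := ExteriorAlgebra ℂ (Fin 5 → ℂ)

/-- The basis vector `e_i` of `ℂ⁵` inside the exterior algebra. -/
def e5 (i : Fin 5) : E5 := ExteriorAlgebra.ι ℂ (Pi.single i 1)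

/-- The 2-vector `σ_u = Σ_{i<j} u_{ij} e_i∧e_j ∈ Λ²ℂ⁵` attached to a point `u ∈ ℂ¹⁰`. -/
def sigma2 (u : {p : Fin 5 × Fin 5 // p.1 < p.2} → ℂ) : E5 :=
  ∑ p : {p : Fin 5 × Fin 5 // p.1 < p.2}, u p • (e5 p.1.1 * e5 p.1.2)


/-- The index set of the ten variables. -/
abbrev S5 : Type := {p : Fin 5 × Fin 5 // p.1 < p.2}

/-- The coordinate ring of pairs `(v, w)`. -/
abbrev TR : Type := MvPolynomial (Fin (5 + 5)) ℂ

/-- Index constructor. -/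
abbrev ix (i j : Fin 5) (h : i < j := by decide) : S5 := ⟨(i, j), h⟩

lemma sum_S5 {M : Type*} [AddCommMonoid M] (g : S5 → M) :
    ∑ p, g p = g (ix 0 1) + g (ix 0 2) + g (ix 0 3) + g (ix 0 4) + g (ix 1 2) + g (ix 1 3)
      + g (ix 1 4) + g (ix 2 3) + g (ix 2 4) + g (ix 3 4) := by
  have h : (Finset.univ : Finset S5) = {ix 0 1, ix 0 2, ix 0 3, ix 0 4, ix 1 2, ix 1 3,
      ix 1 4, ix 2 3, ix 2 4, ix 3 4} := by decide
  rw [h]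
  repeat rw [Finset.sum_insert (by decide)]
  rw [Finset.sum_singleton]
  simp only [add_assoc]

/-- Variables `v_i`. -/
def tv (i : Fin 5) : TR := MvPolynomial.X (Fin.castAdd 5 i)

/-- Variables `w_i`. -/
def tw (i : Fin 5) : TR := MvPolynomial.X (Fin.natAdd 5 i)

/-- Image of the Plücker coordinates. -/
def phiX (p : S5) : TR := tv p.1.1 * tw p.1.2 - tv p.1.2 * tw p.1.1

/-- The Plücker parametrisation. -/
def phi : PR →ₐ[ℂ] TR := MvPolynomial.aeval phiX

lemma phi_X (p : S5) : phi (MvPolynomial.X p) = phiX p := by simp [phi]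

lemma Pf_eqs :
    Pf 0 = MvPolynomial.X (ix 1 2) * MvPolynomial.X (ix 3 4)
      - MvPolynomial.X (ix 1 3) * MvPolynomial.X (ix 2 4)
      + MvPolynomial.X (ix 1 4) * MvPolynomial.X (ix 2 3) ∧
    Pf 1 = MvPolynomial.X (ix 0 2) * MvPolynomial.X (ix 3 4)
      - MvPolynomial.X (ix 0 3) * MvPolynomial.X (ix 2 4)
      + MvPolynomial.X (ix 0 4) * MvPolynomial.X (ix 2 3) ∧
    Pf 2 = MvPolynomial.X (ix 0 1) * MvPolynomial.X (ix 3 4)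
      - MvPolynomial.X (ix 0 3) * MvPolynomial.X (ix 1 4)
      + MvPolynomial.X (ix 0 4) * MvPolynomial.X (ix 1 3) ∧
    Pf 3 = MvPolynomial.X (ix 0 1) * MvPolynomial.X (ix 2 4)
      - MvPolynomial.X (ix 0 2) * MvPolynomial.X (ix 1 4)
      + MvPolynomial.X (ix 0 4) * MvPolynomial.X (ix 1 2) ∧
    Pf 4 = MvPolynomial.X (ix 0 1) * MvPolynomial.X (ix 2 3)
      - MvPolynomial.X (ix 0 2) * MvPolynomial.X (ix 1 3)
      + MvPolynomial.X (ix 0 3) * MvPolynomial.X (ix 1 2) :=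
  ⟨rfl, rfl, rfl, rfl, rfl⟩

lemma phi_Pf (k : Fin 5) : phi (Pf k) = 0 := by
  obtain ⟨h0, h1, h2, h3, h4⟩ := Pf_eqs
  fin_cases k
  · change phi (Pf 0) = 0
    rw [h0]; simp only [map_add, map_sub, map_mul, phi_X, phiX]; ring
  · change phi (Pf 1) = 0
    rw [h1]; simp only [map_add, map_sub, map_mul, phi_X, phiX]; ring
  · change phi (Pf 2) = 0
    rw [h2]; simp only [map_add, map_sub, map_mul, phi_X, phiX]; ring
  · change phi (Pf 3) = 0
    rw [h3]; simp only [map_add, map_sub, map_mul, phi_X, phiX]; ring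
  · change phi (Pf 4) = 0
    rw [h4]; simp only [map_add, map_sub, map_mul, phi_X, phiX]; ring

lemma phi_mem {f : PR} (hf : f ∈ Ideal.span (Set.range Pf)) : phi f = 0 := by
  have h : Ideal.span (Set.range Pf) ≤ RingHom.ker phi := by
    rw [Ideal.span_le]
    rintro _ ⟨k, rfl⟩
    exact phi_Pf k
  exact h hf

/-- The Plücker point of a pair of vectors. -/
def pl (v w : Fin 5 → ℂ) (p : S5) : ℂ := v p.1.1 * w p.1.2 - v p.1.2 * w p.1.1

lemma eval_phi (v w : Fin 5 → ℂ) (f : PR) :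
    MvPolynomial.eval (Fin.append v w) (phi f) = MvPolynomial.eval (pl v w) f := by
  induction f using MvPolynomial.induction_on with
  | C a => simp [phi]
  | add p q hp hq => simp [hp, hq]
  | mul_X p n hp => simp [hp, phi_X, phiX, tv, tw, pl, -Fin.natAdd_eq_addNat]

/-! ### The exterior algebra -/

lemma pl_of_sigma2 (u : S5 → ℂ) (v w : Fin 5 → ℂ)
    (h : sigma2 u = ExteriorAlgebra.ι ℂ v * ExteriorAlgebra.ι ℂ w) : u = pl v w := by
  funext p
  let A : (Fin 5 → ℂ) [⋀^Fin 2]→ₗ[ℂ] ℂ :=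
    (Matrix.detRowAlternating (n := Fin 2) (R := ℂ)).compLinearMap
      (LinearMap.pi ![LinearMap.proj p.1.1, LinearMap.proj p.1.2])
  let F : ∀ i, (Fin 5 → ℂ) [⋀^Fin i]→ₗ[ℂ] ℂ := fun i =>
    if h : i = 2 then h ▸ A else 0
  have key : ∀ x y : Fin 5 → ℂ, ExteriorAlgebra.liftAlternating (R := ℂ) F
      (ExteriorAlgebra.ι ℂ x * ExteriorAlgebra.ι ℂ y) = x p.1.1 * y p.1.2 - x p.1.2 * y p.1.1 := by
    intro x y
    have : ExteriorAlgebra.ι ℂ x * ExteriorAlgebra.ι ℂ y = ExteriorAlgebra.ιMulti ℂ 2 ![x, y] := by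
      simp [ExteriorAlgebra.ιMulti_apply]
    rw [this, ExteriorAlgebra.liftAlternating_apply_ιMulti]
    change Matrix.det (R := ℂ) (n := Fin 2) (Matrix.of fun i =>
      (LinearMap.pi ![LinearMap.proj p.1.1, LinearMap.proj p.1.2] :
        (Fin 5 → ℂ) →ₗ[ℂ] (Fin 2 → ℂ)) (![x, y] i)) = _
    rw [Matrix.det_fin_two]
    simp
  have h2 := congrArg (ExteriorAlgebra.liftAlternating (R := ℂ) F) h
  rw [key] at h2
  rw [pl, ← h2, sigma2, map_sum]
  simp only [map_smul, e5, key]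
  rw [Finset.sum_eq_single p]
  · have h3 := p.2.ne
    simp [h3, h3.symm]
  · rintro ⟨⟨a, b⟩, hab⟩ - hne
    obtain ⟨⟨c, d⟩, hcd⟩ := p
    simp only [ne_eq, Subtype.mk.injEq, Prod.mk.injEq] at hne hab hcd ⊢
    simp only [Pi.single_apply, smul_eq_mul, mul_eq_zero]
    right
    split_ifs <;> grind
  · simp

lemma sigma2_pl (v w : Fin 5 → ℂ) :
    sigma2 (pl v w) = ExteriorAlgebra.ι ℂ v * ExteriorAlgebra.ι ℂ w := by
  have hv : ∀ x : Fin 5 → ℂ, ExteriorAlgebra.ι ℂ x = ∑ i, x i • e5 i := by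
    intro x
    conv_lhs => rw [pi_eq_sum_univ' x]
    simp only [map_sum, map_smul, e5]
  have hsq : ∀ i, e5 i * e5 i = 0 := fun i => ExteriorAlgebra.ι_sq_zero _
  have hsw : ∀ i j, e5 j * e5 i = - (e5 i * e5 j) := by
    intro i j
    rw [eq_neg_iff_add_eq_zero]
    exact ExteriorAlgebra.ι_add_mul_swap _ _
  rw [hv v, hv w, sigma2, sum_S5]
  simp only [Fin.sum_univ_five, mul_add, add_mul, smul_mul_smul_comm, hsq, smul_zero]
  rw [hsw 0 1, hsw 0 2, hsw 0 3, hsw 0 4, hsw 1 2, hsw 1 3, hsw 1 4, hsw 2 3, hsw 2 4, hsw 3 4]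
  simp only [pl]
  module

/-! ### Straightening -/

/-- Standard exponents: no two incomparable variables occur together. -/
def Std (m : S5 →₀ ℕ) : Prop :=
  (m (ix 0 3) = 0 ∨ m (ix 1 2) = 0) ∧ (m (ix 0 4) = 0 ∨ m (ix 1 2) = 0) ∧
  (m (ix 0 4) = 0 ∨ m (ix 1 3) = 0) ∧ (m (ix 0 4) = 0 ∨ m (ix 2 3) = 0) ∧
  (m (ix 1 4) = 0 ∨ m (ix 2 3) = 0)

/-- The weight decreasing under straightening. -/
def wt : (S5 →₀ ℕ) →+ ℕ :=
  Finsupp.weight (fun p : S5 => ((p.1.2 : ℕ) - (p.1.1 : ℕ)) ^ 2)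

lemma wt_single (p : S5) :
    wt (Finsupp.single p 1) = ((p.1.2 : ℕ) - (p.1.1 : ℕ)) ^ 2 := by
  simp [wt, Finsupp.weight_apply]

/-- Ideal plus span of the standard monomials. -/
def NN : Submodule ℂ PR :=
  (Ideal.span (Set.range Pf)).restrictScalars ℂ ⊔ MvPolynomial.restrictSupport ℂ {m | Std m}

lemma step (m : S5 →₀ ℕ) (a b c d e f : S5) (hab : a ≠ b)
    (hI : MvPolynomial.X e * MvPolynomial.X f - MvPolynomial.X c * MvPolynomial.X d
      + MvPolynomial.X a * MvPolynomial.X b ∈ Ideal.span (Set.range Pf))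
    (ha : m a ≠ 0) (hb : m b ≠ 0)
    (h1 : wt (Finsupp.single c 1) + wt (Finsupp.single d 1)
      < wt (Finsupp.single a 1) + wt (Finsupp.single b 1))
    (h2 : wt (Finsupp.single e 1) + wt (Finsupp.single f 1)
      < wt (Finsupp.single a 1) + wt (Finsupp.single b 1))
    (ih : ∀ m' : S5 →₀ ℕ, wt m' < wt m → MvPolynomial.monomial m' (1 : ℂ) ∈ NN) :
    MvPolynomial.monomial m (1 : ℂ) ∈ NN := by
  have hle : Finsupp.single a 1 + Finsupp.single b 1 ≤ m := by
    intro x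
    simp only [Finsupp.add_apply, Finsupp.single_apply]
    split_ifs with h3 h4 h4
    · exact absurd (h3.trans h4.symm) hab
    · subst h3; omega
    · subst h4; omega
    · omega
  obtain ⟨n, rfl⟩ := exists_add_of_le hle
  have e1 := ih (Finsupp.single c 1 + Finsupp.single d 1 + n) (by simp only [map_add]; omega)
  have e2 := ih (Finsupp.single e 1 + Finsupp.single f 1 + n) (by simp only [map_add]; omega)
  have hm : ∀ x y : S5, MvPolynomial.monomial (Finsupp.single x 1 + Finsupp.single y 1 + n) (1 : ℂ)
      = MvPolynomial.X x * MvPolynomial.X y * MvPolynomial.monomial n 1 := by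
    intro x y
    simp [MvPolynomial.X, MvPolynomial.monomial_mul]
  have e3 : MvPolynomial.monomial n (1 : ℂ) * (MvPolynomial.X e * MvPolynomial.X f
      - MvPolynomial.X c * MvPolynomial.X d + MvPolynomial.X a * MvPolynomial.X b) ∈ NN :=
    Submodule.mem_sup_left (Ideal.mul_mem_left _ _ hI)
  rw [hm] at e1 e2 ⊢
  have := NN.sub_mem (NN.add_mem e3 e1) e2
  convert this using 1
  ring

lemma mono_mem (n : ℕ) : ∀ m : S5 →₀ ℕ, wt m = n → MvPolynomial.monomial m (1 : ℂ) ∈ NN := by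
  induction n using Nat.strong_induction_on with
  | _ n IH =>
    intro m hm
    have ih : ∀ m' : S5 →₀ ℕ, wt m' < wt m → MvPolynomial.monomial m' (1 : ℂ) ∈ NN :=
      fun m' h => IH _ (hm ▸ h) m' rfl
    obtain ⟨h0, h1, h2, h3, h4⟩ := Pf_eqs
    have hP : ∀ k, Pf k ∈ Ideal.span (Set.range Pf) := fun k => Ideal.subset_span ⟨k, rfl⟩
    by_cases hs : Std m
    · exact Submodule.mem_sup_right ((MvPolynomial.monomial_mem_restrictSupport ℂ).2 (Or.inl hs))
    · simp only [Std, not_and_or, not_or] at hs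
      rcases hs with ⟨p, q⟩ | ⟨p, q⟩ | ⟨p, q⟩ | ⟨p, q⟩ | ⟨p, q⟩
      · exact step m _ _ _ _ _ _ (by decide) (h4 ▸ hP 4) p q
          (by simp [wt_single]) (by simp [wt_single]) ih
      · exact step m _ _ _ _ _ _ (by decide) (h3 ▸ hP 3) p q
          (by simp [wt_single]) (by simp [wt_single]) ih
      · exact step m _ _ _ _ _ _ (by decide) (h2 ▸ hP 2) p q
          (by simp [wt_single]) (by simp [wt_single]) ih
      · exact step m _ _ _ _ _ _ (by decide) (h1 ▸ hP 1) p q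
          (by simp [wt_single]) (by simp [wt_single]) ih
      · exact step m _ _ _ _ _ _ (by decide) (h0 ▸ hP 0) p q
          (by simp [wt_single]) (by simp [wt_single]) ih

lemma all_mem (f : PR) : f ∈ NN := by
  induction f using MvPolynomial.induction_on' with
  | monomial m a =>
    have := NN.smul_mem a (mono_mem _ m rfl)
    simpa [MvPolynomial.smul_monomial] using this
  | add p q hp hq => exact NN.add_mem hp hq

/-! ### Independence of the standard monomials -/

/-- The lexicographic order on the target. -/
def lx : MonomialOrder (Fin (5 + 5)) := MonomialOrder.lex

/-- Leading exponent of `phiX p`. -/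
def ld (p : S5) : Fin (5 + 5) →₀ ℕ :=
  Finsupp.single (Fin.castAdd 5 p.1.1) 1 + Finsupp.single (Fin.natAdd 5 p.1.2) 1

lemma deg_tvtw (i j : Fin 5) : lx.degree (tv i * tw j) =
    Finsupp.single (Fin.castAdd 5 i) 1 + Finsupp.single (Fin.natAdd 5 j) 1 := by
  rw [tv, tw, MonomialOrder.degree_mul (MvPolynomial.X_ne_zero _) (MvPolynomial.X_ne_zero _),
    MonomialOrder.degree_X, MonomialOrder.degree_X]

lemma deg_phiX (p : S5) : lx.degree (phiX p) = ld p := by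
  obtain ⟨⟨i, j⟩, h⟩ := p
  have h' : i < j := h
  rw [phiX, MonomialOrder.degree_sub_of_lt, deg_tvtw]
  · rfl
  · rw [deg_tvtw, deg_tvtw]
    refine MonomialOrder.lex_lt_iff.2 ⟨Fin.castAdd 5 i, ?_, ?_⟩
    · intro k hk
      simp only [Fin.lt_def, Fin.val_castAdd] at hk h'
      have a1 : Fin.castAdd 5 j ≠ k := by intro h; subst h; simp at hk; omega
      have a2 : Fin.castAdd 5 i ≠ k := by intro h; subst h; simp at hk
      have a3 : Fin.natAdd 5 j ≠ k := by intro h; subst h; simp at hk; omega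
      have a4 : Fin.natAdd 5 i ≠ k := by intro h; subst h; simp at hk
      simp [a1, a2, a3, a4, -Fin.natAdd_eq_addNat]
    · have a1 : Fin.castAdd 5 j ≠ Fin.castAdd 5 i := by
        intro h; simp [Fin.ext_iff] at h; exact absurd h (by omega)
      have a3 : Fin.natAdd 5 j ≠ Fin.castAdd 5 i := by intro h; simp [Fin.ext_iff] at h; omega
      have a4 : Fin.natAdd 5 i ≠ Fin.castAdd 5 i := by intro h; simp [Fin.ext_iff] at h
      simp [a1, a3, a4, -Fin.natAdd_eq_addNat]

lemma phiX_ne (p : S5) : phiX p ≠ 0 := by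
  intro h
  have h1 := deg_phiX p
  rw [h, MonomialOrder.degree_zero] at h1
  have := DFunLike.congr_fun h1 (Fin.castAdd 5 p.1.1)
  simp [ld, -Fin.natAdd_eq_addNat] at this
  omega

/-- Leading exponent of the image of a monomial. -/
def LD (m : S5 →₀ ℕ) : Fin (5 + 5) →₀ ℕ := ∑ p, m p • ld p

lemma phi_mono (m : S5 →₀ ℕ) (a : ℂ) :
    phi (MvPolynomial.monomial m a) = MvPolynomial.C a * ∏ p, phiX p ^ m p := by
  rw [phi, MvPolynomial.aeval_monomial, Finsupp.prod_fintype _ _ (by simp)]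
  rfl

lemma prod_ne (m : S5 →₀ ℕ) : ∏ p, phiX p ^ m p ≠ 0 :=
  Finset.prod_ne_zero_iff.2 fun p _ => pow_ne_zero _ (phiX_ne p)

lemma deg_prod (m : S5 →₀ ℕ) : lx.degree (∏ p, phiX p ^ m p) = LD m := by
  rw [MonomialOrder.degree_prod fun p _ => pow_ne_zero _ (phiX_ne p)]
  simp only [MonomialOrder.degree_pow, deg_phiX, LD]

set_option maxHeartbeats 4000000 in
lemma LD_inj {m n : S5 →₀ ℕ} (hm : Std m) (hn : Std n) (h : LD m = LD n) : m = n := by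
  have H : ∀ k, LD m k = LD n k := fun k => by rw [h]
  simp only [LD, sum_S5, ld, Finsupp.add_apply, Finsupp.smul_apply, Finsupp.single_apply,
    smul_eq_mul] at H
  have r0 := H 0
  have r1 := H 1
  have r2 := H 2
  have r3 := H 3
  have c1 := H 6
  have c2 := H 7
  have c3 := H 8
  have c4 := H 9
  clear H h
  simp [Fin.ext_iff] at r0 r1 r2 r3 c1 c2 c3 c4
  have key : m (ix 0 1) = n (ix 0 1) ∧ m (ix 0 2) = n (ix 0 2) ∧ m (ix 0 3) = n (ix 0 3) ∧
      m (ix 0 4) = n (ix 0 4) ∧ m (ix 1 2) = n (ix 1 2) ∧ m (ix 1 3) = n (ix 1 3) ∧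
      m (ix 1 4) = n (ix 1 4) ∧ m (ix 2 3) = n (ix 2 3) ∧ m (ix 2 4) = n (ix 2 4) ∧
      m (ix 3 4) = n (ix 3 4) := by
    unfold Std at hm hn
    simp only [ix] at *
    generalize m ⟨(0, 1), _⟩ = m01 at *
    generalize m ⟨(0, 2), _⟩ = m02 at *
    generalize m ⟨(0, 3), _⟩ = m03 at *
    generalize m ⟨(0, 4), _⟩ = m04 at *
    generalize m ⟨(1, 2), _⟩ = m12 at *
    generalize m ⟨(1, 3), _⟩ = m13 at *
    generalize m ⟨(1, 4), _⟩ = m14 at *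
    generalize m ⟨(2, 3), _⟩ = m23 at *
    generalize m ⟨(2, 4), _⟩ = m24 at *
    generalize m ⟨(3, 4), _⟩ = m34 at *
    generalize n ⟨(0, 1), _⟩ = n01 at *
    generalize n ⟨(0, 2), _⟩ = n02 at *
    generalize n ⟨(0, 3), _⟩ = n03 at *
    generalize n ⟨(0, 4), _⟩ = n04 at *
    generalize n ⟨(1, 2), _⟩ = n12 at *
    generalize n ⟨(1, 3), _⟩ = n13 at *
    generalize n ⟨(1, 4), _⟩ = n14 at *
    generalize n ⟨(2, 3), _⟩ = n23 at *
    generalize n ⟨(2, 4), _⟩ = n24 at *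
    generalize n ⟨(3, 4), _⟩ = n34 at *
    obtain ⟨x1, x2, x3, x4, x5⟩ := hm
    obtain ⟨y1, y2, y3, y4, y5⟩ := hn
    rcases x1 with x1 | x1 <;> rcases x3 with x3 | x3 <;> rcases x5 with x5 | x5 <;>
    rcases y1 with y1 | y1 <;> rcases y3 with y3 | y3 <;> rcases y5 with y5 | y5 <;>
    refine ⟨?_, ?_, ?_, ?_, ?_, ?_, ?_, ?_, ?_, ?_⟩ <;> omega
  obtain ⟨k0, k1, k2, k3, k4, k5, k6, k7, k8, k9⟩ := key
  ext ⟨⟨i, j⟩, hij⟩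
  fin_cases i <;> fin_cases j <;> first | assumption | exact absurd hij (by decide)

lemma std_indep {h : PR} (hs : h ∈ MvPolynomial.restrictSupport ℂ {m | Std m})
    (h0 : phi h = 0) : h = 0 := by
  rw [MvPolynomial.mem_restrictSupport_iff] at hs
  by_contra hne
  obtain ⟨m, hm, hmax⟩ := h.support.exists_max_image (fun m => lx.toSyn (LD m))
    (MvPolynomial.support_nonempty.2 hne)
  have h1 : phi h = ∑ n ∈ h.support, MvPolynomial.C (h.coeff n) * ∏ p, phiX p ^ n p := by
    conv_lhs => rw [h.as_sum, map_sum]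
    simp only [phi_mono]
  have h2 := congrArg (MvPolynomial.coeff (LD m)) h1
  rw [h0, MvPolynomial.coeff_sum, Finset.sum_eq_single m] at h2
  · rw [MvPolynomial.coeff_C_mul, MvPolynomial.coeff_zero] at h2
    rcases mul_eq_zero.1 h2.symm with h3 | h3
    · exact MvPolynomial.mem_support_iff.1 hm h3
    · rw [← deg_prod, MonomialOrder.coeff_degree_eq_zero_iff] at h3
      exact prod_ne m h3
  · intro n hn hnm
    rw [MvPolynomial.coeff_C_mul, MonomialOrder.coeff_eq_zero_of_lt (m := lx), mul_zero]
    rw [deg_prod]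
    refine lt_of_le_of_ne (hmax n hn) fun he => hnm ?_
    exact LD_inj (hs hn) (hs hm) (lx.toSyn.injective he)
  · exact fun h' => absurd hm h'

/-- the vanishing ideal of the set of `u ∈ ℂ¹⁰` with `σ_u` decomposable
(the affine cone over `Gr(2,5)` in Plücker coordinates) is exactly the ideal `(P₁,…,P₅)`
generated by the five Pfaffian quadrics. -/
theorem vanishingIdeal_cone_eq_pfaffianIdeal (f : PR) :
    (∀ u : {p : Fin 5 × Fin 5 // p.1 < p.2} → ℂ,
        (∃ v w : Fin 5 → ℂ, sigma2 u = ExteriorAlgebra.ι ℂ v * ExteriorAlgebra.ι ℂ w) →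
          MvPolynomial.eval u f = 0) ↔
      f ∈ Ideal.span (Set.range Pf) := by
  constructor
  · intro hf
    have h0 : phi f = 0 := by
      apply MvPolynomial.funext
      intro x
      have hx : x = Fin.append (fun i => x (Fin.castAdd 5 i)) (fun i => x (Fin.natAdd 5 i)) :=
        Fin.append_castAdd_natAdd.symm
      rw [hx, eval_phi, map_zero]
      exact hf _ ⟨_, _, sigma2_pl _ _⟩
    obtain ⟨g, hg, h, hh, rfl⟩ := Submodule.mem_sup.1 (all_mem f)
    have hg' : g ∈ Ideal.span (Set.range Pf) := hg
    rw [map_add, phi_mem hg', zero_add] at h0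
    rw [std_indep hh h0, add_zero]
    exact hg'
  · rintro hf u ⟨v, w, h⟩
    rw [pl_of_sigma2 u v w h, ← eval_phi, phi_mem hf, map_zero]
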